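/- arXiv:2603.18952 — 2 statements merged into one kernel-verified Lean document; each statement's English description precedes it below -/
import Mathlib

section
/- Let G be a simple graph with n vertices and e edges such that e ≥ n²/4 + 4. If the minimum degree δ of G satisfies δ ≥ n/2 − √(e − n²/4) + 2, then any two vertices of G are connected by a path of length exactly 4. -/
open SimpleGraph

/-- The number of pairs in `S × T` that are adjacent in `G`. -/
def adjCount {V : Type*} (G : SimpleGraph V) [DecidableRel G.Adj] (S T : Finset V) : ℕ :=
  ∑ z ∈ S, (T.filter (G.Adj z)).card

section adjCount

variable {V : Type*} (G : SimpleGraph V) [DecidableRel G.Adj]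

lemma adjCount_comm (S T : Finset V) : adjCount G S T = adjCount G T S := by
  simp only [adjCount, Finset.card_filter]
  rw [Finset.sum_comm]
  simp only [G.adj_comm]

lemma adjCount_union_left [DecidableEq V] {S₁ S₂ : Finset V} (h : Disjoint S₁ S₂) (T : Finset V) :
    adjCount G (S₁ ∪ S₂) T = adjCount G S₁ T + adjCount G S₂ T :=
  Finset.sum_union h

lemma adjCount_union_right [DecidableEq V] (S : Finset V) {T₁ T₂ : Finset V}
    (h : Disjoint T₁ T₂) :
    adjCount G S (T₁ ∪ T₂) = adjCount G S T₁ + adjCount G S T₂ := by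
  rw [adjCount_comm, adjCount_union_left G h, adjCount_comm G T₁, adjCount_comm G T₂]

lemma adjCount_union_self [DecidableEq V] {S T : Finset V} (h : Disjoint S T) :
    adjCount G (S ∪ T) (S ∪ T) = adjCount G S S + 2 * adjCount G T S + adjCount G T T := by
  rw [adjCount_union_left G h, adjCount_union_right G _ h, adjCount_union_right G _ h,
    adjCount_comm G S T]
  ring

lemma adjCount_le_mul (S T : Finset V) (k : ℕ)
    (h : ∀ z ∈ S, (T.filter (G.Adj z)).card ≤ k) : adjCount G S T ≤ S.card * k := by
  simpa [adjCount] using Finset.sum_le_card_nsmul S _ k h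

lemma adjCount_self_le (D : Finset V) : adjCount G D D ≤ D.card * (D.card - 1) := by
  classical
  refine adjCount_le_mul G D D _ fun z hz => ?_
  rw [← Finset.card_erase_of_mem hz]
  refine Finset.card_le_card fun w hw => ?_
  rw [Finset.mem_filter] at hw
  exact Finset.mem_erase.2 ⟨hw.2.ne', hw.1⟩

lemma adjCount_univ [Fintype V] : adjCount G Finset.univ Finset.univ = 2 * G.edgeSet.ncard := by
  classical
  rw [Set.ncard_eq_toFinset_card', ← SimpleGraph.edgeFinset, ← G.sum_degrees_eq_twice_card_edges]
  refine Finset.sum_congr rfl fun v _ => ?_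
  rw [← G.card_neighborFinset_eq_degree]
  congr 1
  ext w
  simp

/-- The adjacencies at two distinct vertices `x`, `y` account for at most
`2 * (|A| + |B| + 1)` ordered pairs, where `A` and `B` are their remaining neighbours. -/
lemma adjCount_univ_le [Fintype V] [DecidableEq V] {x y : V} (hxy : x ≠ y) {H : Finset V}
    (hH : H = Finset.univ \ {x, y}) :
    adjCount G Finset.univ Finset.univ ≤
      adjCount G H H + 2 * (H.filter (G.Adj x)).card + 2 * (H.filter (G.Adj y)).card + 2 := by
  have hd : Disjoint ({x, y} : Finset V) H := hH ▸ Finset.disjoint_sdiff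
  have hu : (Finset.univ : Finset V) = {x, y} ∪ H := by simp [hH]
  rw [hu, adjCount_union_self G hd, adjCount_comm G H]
  have h1 := adjCount_self_le G {x, y}
  rw [Finset.card_pair hxy] at h1
  have h2 : adjCount G {x, y} H = (H.filter (G.Adj x)).card + (H.filter (G.Adj y)).card :=
    Finset.sum_pair hxy
  omega

end adjCount

section Split

variable {V : Type*} [DecidableEq V] {G : SimpleGraph V} [DecidableRel G.Adj] {A B H : Finset V}

/-- If the neighbourhood of `z` never contains distinct representatives of `A` and `B`, then its
trace on `A ∪ B` is a subset of `A \ B`, or of `B \ A`, or a single vertex of `A ∩ B`. -/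
lemma card_adj_union_le {z : V} (hz : ∀ a ∈ A, ∀ b ∈ B, G.Adj z a → G.Adj z b → a = b) :
    ((A \ B ∪ B \ A ∪ A ∩ B).filter (G.Adj z)).card ≤
      max (max (A \ B).card (B \ A).card) 1 := by
  by_cases hC : ∃ c ∈ A ∩ B, G.Adj z c
  · obtain ⟨c, hc, hzc⟩ := hC
    rw [Finset.mem_inter] at hc
    refine le_trans ?_ (le_max_right _ _)
    rw [← Finset.card_singleton c]
    refine Finset.card_le_card fun w hw => ?_
    simp only [Finset.mem_filter, Finset.mem_union, Finset.mem_sdiff, Finset.mem_inter,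
      Finset.mem_singleton] at hw ⊢
    have h1 := hz w
    have h2 := hz c hc.1 w
    grind
  refine le_trans ?_ (le_max_left _ _)
  by_cases hA : ∃ a ∈ A \ B, G.Adj z a
  · obtain ⟨a, ha, hza⟩ := hA
    refine le_trans (Finset.card_le_card fun w hw => ?_) (le_max_left _ _)
    simp only [Finset.mem_filter, Finset.mem_union, Finset.mem_sdiff, Finset.mem_inter] at hw ha ⊢
    have h2 := hz a ha.1 w
    grind
  · refine le_trans (Finset.card_le_card fun w hw => ?_) (le_max_right _ _)
    simp only [Finset.mem_filter, Finset.mem_union] at hw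
    grind

/-- If no vertex of `A ∪ B` is adjacent to distinct representatives of `A` and `B`, then
`A ∪ B` spans few edges. -/
lemma adjCount_union_self_le
    (h : ∀ z ∈ A ∪ B, ∀ a ∈ A, ∀ b ∈ B, G.Adj z a → G.Adj z b → a = b) :
    adjCount G (A \ B ∪ B \ A ∪ A ∩ B) (A \ B ∪ B \ A ∪ A ∩ B) ≤
      (A \ B).card ^ 2 + (B \ A).card ^ 2 + 2 + (A ∩ B).card := by
  classical
  set A' := A \ B with hA'
  set B' := B \ A with hB'
  set C := A ∩ B with hC
  set U := A' ∪ B' ∪ C with hU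
  have hAB : Disjoint A' B' := by
    rw [Finset.disjoint_left]; grind
  have hABC : Disjoint (A' ∪ B') C := by
    rw [Finset.disjoint_left]; grind
  have hUm : ∀ z, z ∈ U ↔ z ∈ A ∪ B := by intro z; grind
  let T : V → Prop := fun z => ∃ c ∈ C, G.Adj z c
  let P : V → Prop := fun z => ¬ T z ∧ ∃ a ∈ A', G.Adj z a
  let Q : V → Prop := fun z => ¬ T z ∧ ¬ ∃ a ∈ A', G.Adj z a
  have hcard : ∀ S : Finset V,
      (S.filter P).card + (S.filter Q).card + (S.filter T).card = S.card := by
    intro S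
    rw [← Finset.card_filter_add_card_filter_not (s := S) T,
      ← Finset.card_filter_add_card_filter_not (s := S.filter (fun z => ¬ T z))
        (fun z => ∃ a ∈ A', G.Adj z a), Finset.filter_filter, Finset.filter_filter]
    change _ = _ + ((S.filter P).card + (S.filter Q).card)
    ring
  have hsplit : ∀ S R : Finset V, adjCount G S R =
      adjCount G (S.filter P) R + adjCount G (S.filter Q) R + adjCount G (S.filter T) R := by
    intro S R
    unfold adjCount
    rw [← Finset.sum_filter_add_sum_filter_not S T,
      ← Finset.sum_filter_add_sum_filter_not (S.filter (fun z => ¬ T z))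
        (fun z => ∃ a ∈ A', G.Adj z a), Finset.filter_filter, Finset.filter_filter]
    change _ + (∑ z ∈ S.filter P, _ + ∑ z ∈ S.filter Q, _) = _
    ring
  have hT : ∀ z ∈ U, T z → (U.filter (G.Adj z)).card ≤ 1 := by
    rintro z hz ⟨c, hc, hzc⟩
    rw [← Finset.card_singleton c]
    refine Finset.card_le_card fun w hw => ?_
    have := h z ((hUm z).1 hz)
    rw [Finset.mem_filter, hUm] at hw
    grind
  have hTs : ∀ S ⊆ U, adjCount G (S.filter T) U ≤ (S.filter T).card := by
    intro S hS
    simpa using adjCount_le_mul G (S.filter T) U 1 fun z hz =>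
      hT z (hS (Finset.mem_filter.1 hz).1) (Finset.mem_filter.1 hz).2
  have hTC : ∀ z w, z ∈ U → w ∈ U → w ∉ C → T z → ¬ G.Adj z w := by
    rintro z w hz hw hwC ⟨c, hc, hzc⟩ hzw
    have := h z ((hUm z).1 hz)
    rw [hUm] at hw
    grind
  have hsub : ∀ (S R : Finset V) (p q : V → Prop) [DecidablePred p] [DecidablePred q],
      (∀ z ∈ S, p z → ∀ w ∈ U, G.Adj z w → w ∈ R ∧ q w) →
      adjCount G (S.filter p) U ≤ (S.filter p).card * (R.filter q).card := by
    intro S R p q _ _ hpq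
    refine adjCount_le_mul G _ _ _ fun z hz => Finset.card_le_card fun w hw => ?_
    rw [Finset.mem_filter] at hz hw ⊢
    exact hpq z hz.1 hz.2 w hw.1 hw.2
  have hPmem : ∀ z ∈ U, P z → ∀ w ∈ U, G.Adj z w → w ∈ A' := by
    rintro z hz ⟨hTz, a, ha, hza⟩ w hw hzw
    have := h z ((hUm z).1 hz)
    have hwC : w ∉ C := fun hw => hTz ⟨w, hw, hzw⟩
    grind
  have hQmem : ∀ z ∈ U, Q z → ∀ w ∈ U, G.Adj z w → w ∈ B' := by
    rintro z hz ⟨hTz, hza⟩ w hw hzw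
    have hwC : w ∉ C := fun hw => hTz ⟨w, hw, hzw⟩
    have hwA : w ∉ A' := fun hw => hza ⟨w, hw, hzw⟩
    grind
  have hAP : ∀ z ∈ A', ∀ w ∈ U, G.Adj z w → P w := by
    intro z hz w hw hzw
    exact ⟨fun hTw => hTC w z hw (by grind) (by grind) hTw hzw.symm, z, hz, hzw.symm⟩
  have hBQ : ∀ z ∈ B', ∀ w ∈ U, G.Adj z w → Q w := by
    intro z hz w hw hzw
    refine ⟨fun hTw => hTC w z hw (by grind) (by grind) hTw hzw.symm, ?_⟩
    rintro ⟨a, ha, hwa⟩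
    have := h w ((hUm w).1 hw) a (by grind) z (by grind) hwa hzw.symm
    grind
  have hAU : A' ⊆ U := by grind
  have hBU : B' ⊆ U := by grind
  have hA1 : adjCount G (A'.filter P) U ≤ (A'.filter P).card * (A'.filter P).card :=
    hsub A' A' P P fun z hz hp w hw hzw => ⟨hPmem z (hAU hz) hp w hw hzw, hAP z hz w hw hzw⟩
  have hA2 : adjCount G (A'.filter Q) U ≤ (A'.filter Q).card * (B'.filter P).card :=
    hsub A' B' Q P fun z hz hp w hw hzw => ⟨hQmem z (hAU hz) hp w hw hzw, hAP z hz w hw hzw⟩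
  have hB1 : adjCount G (B'.filter P) U ≤ (B'.filter P).card * (A'.filter Q).card :=
    hsub B' A' P Q fun z hz hp w hw hzw => ⟨hPmem z (hBU hz) hp w hw hzw, hBQ z hz w hw hzw⟩
  have hB2 : adjCount G (B'.filter Q) U ≤ (B'.filter Q).card * (B'.filter Q).card :=
    hsub B' B' Q Q fun z hz hp w hw hzw => ⟨hQmem z (hBU hz) hp w hw hzw, hBQ z hz w hw hzw⟩
  have hA3 := hTs A' hAU
  have hB3 := hTs B' hBU
  have hC3 : adjCount G C U ≤ C.card + (A'.filter T).card + (B'.filter T).card := by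
    have h1 : adjCount G C U ≤ (U.filter T).card := by
      rw [adjCount_comm, adjCount, Finset.card_filter]
      refine Finset.sum_le_sum fun z hz => ?_
      split_ifs with hTz
      · exact le_trans (Finset.card_le_card (Finset.filter_subset_filter _
          Finset.subset_union_right)) (hT z hz hTz)
      · rw [Nat.le_zero, Finset.card_eq_zero, Finset.filter_eq_empty_iff]
        exact fun c hc hzc => hTz ⟨c, hc, hzc⟩
    have h2 : (U.filter T).card ≤ (A'.filter T).card + (B'.filter T).card + (C.filter T).card := by
      rw [hU, Finset.filter_union, Finset.filter_union]
      exact (Finset.card_union_le _ _).trans (Nat.add_le_add_right (Finset.card_union_le _ _) _)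
    have h3 := Finset.card_filter_le C T
    omega
  have hsum : adjCount G U U = adjCount G A' U + adjCount G B' U + adjCount G C U := by
    conv_lhs => rw [show adjCount G U U = adjCount G (A' ∪ B' ∪ C) U from rfl]
    rw [adjCount_union_left G hABC, adjCount_union_left G hAB]
  rw [hsum, hsplit A', hsplit B', ← hcard A', ← hcard B']
  generalize (A'.filter P).card = a₁ at *
  generalize (A'.filter Q).card = a₂ at *
  generalize (A'.filter T).card = a₃ at *
  generalize (B'.filter P).card = b₁ at *
  generalize (B'.filter Q).card = b₂ at *
  generalize (B'.filter T).card = b₃ at *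
  have key : a₁ * a₁ + a₂ * b₁ + b₁ * a₂ + b₂ * b₂ + 2 * a₃ + 2 * b₃ ≤
      (a₁ + a₂ + a₃) ^ 2 + (b₁ + b₂ + b₃) ^ 2 + 2 := by
    have e1 : 0 ≤ (a₁ * a₂ + a₁ * a₃ + a₂ * a₃ + b₁ * b₂ + b₁ * b₃ + b₂ * b₃ : ℤ) := by positivity
    zify
    nlinarith [sq_nonneg ((a₂ : ℤ) - b₁), sq_nonneg ((a₃ : ℤ) - 1), sq_nonneg ((b₃ : ℤ) - 1)]
  omega

end Split

/-- The edge count forced by the absence of a path of length four is incompatible with the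
edge and degree hypotheses. -/
lemma edge_bound_lt {m k s μ γ : ℝ} (hs : 2 ≤ s) (hk : k = m / 2 - s + 2) (hγ : 0 ≤ γ)
    (hkμ : k ≤ μ) (hγμ : γ ≤ μ) (hμ : 2 * μ ≤ m + γ) :
    (m - μ) ^ 2 + (μ - γ) ^ 2 + 3 * γ + 2 < m ^ 2 / 2 + 2 * s ^ 2 := by
  have hs' : s = m / 2 - k + 2 := by linarith
  have hkm : 2 * k ≤ m := by linarith
  have hγm : γ ≤ m := by linarith
  have hend : 0 ≤ k → (m - k) ^ 2 + 3 * k + 2 < m ^ 2 / 2 + 2 * s ^ 2 := by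
    intro hk0
    subst hs'
    nlinarith [sq_nonneg (2 * k - 3)]
  rcases le_or_gt γ k with h | h
  · have hmono : (m - μ) ^ 2 + (μ - γ) ^ 2 ≤ (m - k) ^ 2 + (k - γ) ^ 2 := by
      nlinarith [mul_nonneg (sub_nonneg.2 hkμ) (by linarith : 0 ≤ m + γ - μ - k)]
    have hk0 : 0 ≤ k := hγ.trans h
    have hconv : (k - γ) ^ 2 ≤ k * (k - γ) := by
      nlinarith [mul_nonneg hγ (sub_nonneg.2 h)]
    rcases le_or_gt k 3 with h3 | h3
    · have := hend hk0
      nlinarith [mul_nonneg (sub_nonneg.2 h) (sub_nonneg.2 h3)]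
    · subst hs'
      nlinarith [mul_nonneg hγ (sub_nonneg.2 h3.le)]
  · have hmono : (m - μ) ^ 2 + (μ - γ) ^ 2 ≤ (m - γ) ^ 2 := by
      nlinarith [mul_nonneg (sub_nonneg.2 hγμ) (by linarith : 0 ≤ m - μ)]
    have htop : 3 * m + 2 < m ^ 2 / 2 + 2 * s ^ 2 := by
      nlinarith [sq_nonneg (m - 3)]
    obtain ⟨k₀, hk₀γ, hk₀⟩ : ∃ k₀ ≤ γ, (m - k₀) ^ 2 + 3 * k₀ + 2 < m ^ 2 / 2 + 2 * s ^ 2 := by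
      rcases le_or_gt 0 k with h0 | h0
      · exact ⟨k, h.le, hend h0⟩
      · refine ⟨0, hγ, ?_⟩
        nlinarith [mul_self_le_mul_self (by linarith : 0 ≤ m / 2 + 2) (by linarith : m / 2 + 2 ≤ s)]
    -- The left-hand side is convex in `γ`, so it suffices to compare at `k₀` and `m`.
    have hconv : (m - γ) ^ 2 ≤ (m - γ) * (m - k₀) := by
      nlinarith [mul_nonneg (sub_nonneg.2 hγm) (sub_nonneg.2 hk₀γ)]
    rcases le_or_gt (m - k₀) 3 with h3 | h3
    · nlinarith [mul_nonneg (sub_nonneg.2 hγm) (sub_nonneg.2 h3)]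
    · nlinarith [mul_nonneg (sub_nonneg.2 hk₀γ) (sub_nonneg.2 h3.le)]

lemma four_path_numeric {a b g d m : ℕ} {e s : ℝ} (hm : a + b + g + d = m) (hs : 2 ≤ s)
    (he : ((m : ℝ) + 2) ^ 2 / 4 + s ^ 2 ≤ e)
    (ha : ((m : ℝ) + 2) / 2 - s + 1 ≤ a + g) (hb : ((m : ℝ) + 2) / 2 - s + 1 ≤ b + g)
    (h : 2 * e ≤ 2 * (a + g) + 2 * (b + g) + 2 + ((a : ℝ) ^ 2 + b ^ 2 + 2 + g) +
      2 * (d * max (max (a : ℝ) b) 1) + d * (d - 1)) : False := by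
  wlog hab : b ≤ a generalizing a b
  · refine this (a := b) (b := a) (by omega) hb ha ?_ (by omega)
    rw [max_comm (b : ℝ)]
    linarith
  have hmR : (a : ℝ) + b + g + d = m := by exact_mod_cast hm
  have habR : (b : ℝ) ≤ a := by exact_mod_cast hab
  have hd : (0 : ℝ) ≤ d := d.cast_nonneg
  have hg : (0 : ℝ) ≤ g := g.cast_nonneg
  have hb0 : (0 : ℝ) ≤ b := b.cast_nonneg
  have key := edge_bound_lt (m := m) (k := (m : ℝ) / 2 - s + 2) (μ := b + g) (γ := g) hs rfl hg
    (by linarith) (by linarith) (by linarith)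
  rw [max_eq_left habR] at h
  rw [← hmR] at key he
  rcases Nat.eq_zero_or_pos a with h0 | h0
  · obtain rfl : b = 0 := by omega
    subst h0
    norm_num at h key he
    nlinarith
  · rw [max_eq_left (by exact_mod_cast h0)] at h
    nlinarith

/-- Let `G` be a simple graph with `n` vertices and `e ≥ n²/4 + 4` edges whose minimum degree
`δ` satisfies `δ ≥ n/2 - √(e - n²/4) + 2`. Then any two (distinct) vertices of `G` are
connected by a path of length exactly `4`. -/
theorem statement6 {V : Type} [Fintype V] (G : SimpleGraph V) [DecidableRel G.Adj]
    (n e : ℕ) (hn : Fintype.card V = n) (he : G.edgeSet.ncard = e)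
    (he' : (n : ℝ) ^ 2 / 4 + 4 ≤ (e : ℝ))
    (hδ : ∀ v : V, (n : ℝ) / 2 - Real.sqrt ((e : ℝ) - (n : ℝ) ^ 2 / 4) + 2 ≤ (G.degree v : ℝ)) :
    ∀ x y : V, x ≠ y → ∃ p : G.Walk x y, p.IsPath ∧ p.length = 4 := by
  classical
  intro x y hxy
  by_contra hno
  set H : Finset V := Finset.univ \ {x, y} with hH
  set A := H.filter (G.Adj x) with hA
  set B := H.filter (G.Adj y) with hB
  have hsep : ∀ z ∈ H, ∀ a ∈ A, ∀ b ∈ B, G.Adj z a → G.Adj z b → a = b := by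
    intro z hz a ha b hb hza hzb
    by_contra hab
    simp only [hA, hB, hH, Finset.mem_filter, Finset.mem_sdiff, Finset.mem_univ, true_and,
      Finset.mem_insert, Finset.mem_singleton, not_or] at hz ha hb
    refine hno ⟨.cons ha.2 (.cons hza.symm (.cons hzb (.cons hb.2.symm .nil))), ?_, rfl⟩
    have := hza.ne
    have := hzb.ne
    simp [Walk.cons_isPath_iff]
    grind
  set U := A \ B ∪ B \ A ∪ A ∩ B with hU
  set D := H \ U with hD
  have hUH : U ⊆ H := by grind
  have hUD : Disjoint U D := Finset.disjoint_sdiff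
  have hHUD : U ∪ D = H := Finset.union_sdiff_of_subset hUH
  have h1 := adjCount_univ_le G hxy hH
  have h2 := adjCount_union_self G hUD
  have h3 : adjCount G U U ≤ _ :=
    adjCount_union_self_le fun z hz => hsep z (by grind)
  have h4 : adjCount G D U ≤ _ :=
    adjCount_le_mul G D U _ fun z hz => card_adj_union_le (hsep z (Finset.sdiff_subset hz))
  have h5 := adjCount_self_le G D
  rw [adjCount_univ, he] at h1
  rw [hHUD] at h2
  have cA : (A \ B).card + (A ∩ B).card = A.card := Finset.card_sdiff_add_card_inter A B
  have cB : (B \ A).card + (A ∩ B).card = B.card := by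
    rw [Finset.inter_comm]; exact Finset.card_sdiff_add_card_inter B A
  have cU : U.card = (A \ B).card + (B \ A).card + (A ∩ B).card := by
    rw [hU, Finset.card_union_of_disjoint, Finset.card_union_of_disjoint]
    all_goals rw [Finset.disjoint_left]; grind
  have cH : (A \ B).card + (B \ A).card + (A ∩ B).card + D.card = H.card := by
    rw [← cU, ← Finset.card_union_of_disjoint hUD, hHUD]
  have cn : H.card + 2 = n := by
    rw [← hn, ← Finset.card_univ, ← Finset.card_pair hxy, hH]
    exact Finset.card_sdiff_add_card_eq_card (Finset.subset_univ _)
  have hdeg : ∀ u v : V, {u, v} = ({x, y} : Finset V) →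
      G.degree u ≤ (H.filter (G.Adj u)).card + 1 := by
    intro u v huv
    rw [← G.card_neighborFinset_eq_degree, ← Finset.card_singleton v]
    refine (Finset.card_le_card fun w hw => ?_).trans (Finset.card_union_le _ _)
    have := (G.mem_neighborFinset u w).1 hw
    have := this.ne
    rw [hH, ← huv]
    grind
  have hx := hdeg x y rfl
  have hy := hdeg y x (Finset.pair_comm y x)
  rw [← hA, ← cA] at hx h1
  rw [← hB, ← cB] at hy h1
  have hs0 : (0 : ℝ) ≤ e - (n : ℝ) ^ 2 / 4 := by linarith
  have hsq := Real.sq_sqrt hs0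
  have hs2 : 2 ≤ Real.sqrt ((e : ℝ) - (n : ℝ) ^ 2 / 4) := Real.le_sqrt_of_sq_le (by linarith)
  have hδx := hδ x
  have hδy := hδ y
  set s := Real.sqrt ((e : ℝ) - (n : ℝ) ^ 2 / 4)
  have cnR : (H.card : ℝ) + 2 = n := by exact_mod_cast cn
  have hxR : (G.degree x : ℝ) ≤ (A \ B).card + (A ∩ B).card + 1 := by exact_mod_cast hx
  have hyR : (G.degree y : ℝ) ≤ (B \ A).card + (A ∩ B).card + 1 := by exact_mod_cast hy
  refine four_path_numeric (e := e) cH hs2 ?_ ?_ ?_ ?_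
  · rw [cnR]; linarith
  · rw [cnR]; linarith
  · rw [cnR]; linarith
  · have h5' : ((adjCount G D D : ℕ) : ℝ) ≤ D.card * ((D.card : ℝ) - 1) := by
      rcases Nat.eq_zero_or_pos D.card with h0 | h0
      · rw [h0] at h5 ⊢
        simpa using h5
      · rw [← Nat.cast_pred h0]
        exact_mod_cast h5
    have h4' : ((adjCount G D U : ℕ) : ℝ) ≤
        D.card * max (max ((A \ B).card : ℝ) (B \ A).card) 1 := by exact_mod_cast h4
    have h3' : ((adjCount G U U : ℕ) : ℝ) ≤
        ((A \ B).card : ℝ) ^ 2 + (B \ A).card ^ 2 + 2 + (A ∩ B).card := by exact_mod_cast h3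
    have h2' : ((adjCount G H H : ℕ) : ℝ) =
      adjCount G U U + 2 * adjCount G D U + adjCount G D D := by exact_mod_cast h2
    have h1' : 2 * (e : ℝ) ≤ adjCount G H H + 2 * ((A \ B).card + (A ∩ B).card) +
      2 * ((B \ A).card + (A ∩ B).card) + 2 := by exact_mod_cast h1
    linarith
end

section
/- Let k ≥ 2 be an integer and let G be a simple graph with n vertices and e edges such that n ≥ 2k, e ≥ n²/4 + 2kn, and the minimum degree δ of G satisfies δ ≥ n/2 − √(e − 2kn − n²/4) + 2k. Then for every vertex set T of G with |T| ≤ 2k − 4 and any two vertices x, y ∉ T, there is a path of length exactly 4 connecting x and y in the induced subgraph G[V \ T], i.e., a path of length 4 from x to y in G avoiding all vertices of T. -/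
open SimpleGraph

open Finset in
/-- If every vertex of `P` has at most one neighbor in `B` and every vertex of `Q` has at most one
neighbor in `A`, where `|A| = |B| = t`, then the number of adjacent ordered pairs in `P ∪ Q` is
bounded as for two overlapping cliques. -/
lemma card_adj_pairs_add_le {V : Type*} [DecidableEq V] (G : SimpleGraph V) [DecidableRel G.Adj]
    (P Q A B : Finset V) (t : ℕ) (hPQ : Disjoint P Q) (hA : A ⊆ P ∪ Q) (hB : B ⊆ P ∪ Q)
    (hAt : #A = t) (hBt : #B = t)
    (hP : ∀ u ∈ P, ∀ v ∈ B, ∀ w ∈ B, G.Adj u v → G.Adj u w → v = w)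
    (hQ : ∀ u ∈ Q, ∀ v ∈ A, ∀ w ∈ A, G.Adj u v → G.Adj u w → v = w) :
    #{p ∈ (P ∪ Q) ×ˢ (P ∪ Q) | G.Adj p.1 p.2} + 2 * t * #(P ∪ Q)
      ≤ #(P ∪ Q) ^ 2 + 2 * t ^ 2 + 2 * #(P ∪ Q) := by
  have hdis : ∀ v ∈ P, v ∉ Q := fun v h h' => Finset.disjoint_left.mp hPQ h h'
  have hm : #(P ∪ Q) = #P + #Q := card_union_of_disjoint hPQ
  set F := {p ∈ (P ∪ Q) ×ˢ (P ∪ Q) | G.Adj p.1 p.2} with hF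
  set S₁ := P ×ˢ B ∪ Q ×ˢ A with hS₁
  set S₂ := B ×ˢ P ∪ A ×ˢ Q with hS₂
  have c₁ : #S₁ = t * #(P ∪ Q) := by
    rw [hS₁, card_union_of_disjoint, card_product, card_product, hm, hAt, hBt]
    · ring
    · exact disjoint_product.mpr (Or.inl hPQ)
  have c₂ : #S₂ = t * #(P ∪ Q) := by
    rw [hS₂, card_union_of_disjoint, card_product, card_product, hm, hAt, hBt]
    · ring
    · exact disjoint_product.mpr (Or.inr hPQ)
  have cF₁ : #(F ∩ S₁) ≤ #(P ∪ Q) := by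
    apply card_le_card_of_injOn Prod.fst
    · rintro ⟨u, v⟩ h
      simp only [hF, coe_inter, Set.mem_inter_iff, mem_coe, mem_filter, mem_product] at h
      exact h.1.1.1
    · rintro ⟨u, v⟩ h ⟨u', w⟩ h' (rfl : u = u')
      simp only [hF, hS₁, coe_inter, Set.mem_inter_iff, mem_coe, mem_filter, mem_product,
        mem_union] at h h'
      grind
  have cF₂ : #(F ∩ S₂) ≤ #(P ∪ Q) := by
    apply card_le_card_of_injOn Prod.snd
    · rintro ⟨u, v⟩ h
      simp only [hF, coe_inter, Set.mem_inter_iff, mem_coe, mem_filter, mem_product] at h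
      exact h.1.1.2
    · rintro ⟨v, u⟩ h ⟨w, u'⟩ h' (rfl : u = u')
      simp only [hF, hS₂, coe_inter, Set.mem_inter_iff, mem_coe, mem_filter, mem_product,
        mem_union] at h h'
      have := h.1.2.symm
      have := h'.1.2.symm
      grind
  have cS : #(S₁ ∩ S₂) ≤ 2 * t ^ 2 := by
    have hsub : S₁ ∩ S₂ ⊆ ((A ∩ Q) ×ˢ (A ∩ Q) ∪ (B ∩ P) ×ˢ (B ∩ P)) ∪
        ((A ∩ P) ×ˢ (B ∩ Q) ∪ (B ∩ Q) ×ˢ (A ∩ P)) := by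
      rintro ⟨u, v⟩ h
      simp only [hS₁, hS₂, mem_inter, mem_union, mem_product] at h ⊢
      obtain ⟨⟨hu, hv⟩ | ⟨hu, hv⟩, ⟨hu', hv'⟩ | ⟨hu', hv'⟩⟩ := h <;> simp [*]
    have h₁ := card_le_card hsub
    have h₂ := card_union_le ((A ∩ Q) ×ˢ (A ∩ Q) ∪ (B ∩ P) ×ˢ (B ∩ P))
      ((A ∩ P) ×ˢ (B ∩ Q) ∪ (B ∩ Q) ×ˢ (A ∩ P))
    have h₃ := card_union_le ((A ∩ Q) ×ˢ (A ∩ Q)) ((B ∩ P) ×ˢ (B ∩ P))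
    have h₄ := card_union_le ((A ∩ P) ×ˢ (B ∩ Q)) ((B ∩ Q) ×ˢ (A ∩ P))
    simp only [card_product] at h₂ h₃ h₄
    have split : ∀ C ⊆ P ∪ Q, #(C ∩ P) + #(C ∩ Q) = #C := by
      intro C hC
      rw [← card_union_of_disjoint (hPQ.mono inter_subset_right inter_subset_right),
        ← inter_union_distrib_left, inter_eq_left.mpr hC]
    have hA' := split A hA
    have hB' := split B hB
    rw [hAt] at hA'
    rw [hBt] at hB'
    refine (h₁.trans (h₂.trans (add_le_add h₃ h₄))).trans ?_
    generalize #(A ∩ P) = a at *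
    generalize #(A ∩ Q) = b at *
    generalize #(B ∩ P) = c at *
    generalize #(B ∩ Q) = d at *
    have : (b + c) * (b + c) ≤ (b + c) * (2 * t) := Nat.mul_le_mul_left _ (by omega)
    zify at *
    rw [show (a : ℤ) = t - b by linarith, show (d : ℤ) = t - c by linarith]
    nlinarith
  have hU : #(F ∪ (S₁ ∪ S₂)) ≤ #(P ∪ Q) ^ 2 := by
    rw [pow_two, ← card_product]
    apply card_le_card
    rintro ⟨u, v⟩ h
    simp only [hF, hS₁, hS₂, mem_union, mem_filter, mem_product] at h ⊢
    simp only [subset_iff, mem_union] at hA hB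
    grind
  have e₁ := card_union_add_card_inter F (S₁ ∪ S₂)
  have e₂ := card_union_add_card_inter S₁ S₂
  have e₃ : #(F ∩ (S₁ ∪ S₂)) ≤ #(F ∩ S₁) + #(F ∩ S₂) := by
    rw [inter_union_distrib_left]
    exact card_union_le _ _
  have : 2 * t * #(P ∪ Q) = t * #(P ∪ Q) + t * #(P ∪ Q) := by ring
  omega

open Finset in
/-- Twice the number of edges is at most the number of adjacent ordered pairs inside `W` plus
`2 |Wᶜ| |V|`. -/
lemma two_mul_ncard_edgeSet_le {V : Type*} [Fintype V] [DecidableEq V] (G : SimpleGraph V)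
    [DecidableRel G.Adj] (W : Finset V) :
    2 * G.edgeSet.ncard ≤
      #{p ∈ W ×ˢ W | G.Adj p.1 p.2} + 2 * (#Wᶜ * Fintype.card V) := by
  have hdeg : 2 * G.edgeSet.ncard = #{p : V × V | G.Adj p.1 p.2} := by
    rw [← G.coe_edgeFinset, Set.ncard_coe_finset, ← G.sum_degrees_eq_twice_card_edges,
      card_filter, Fintype.sum_prod_type]
    refine sum_congr rfl fun v _ => ?_
    rw [← card_filter, ← G.card_neighborFinset_eq_degree, G.neighborFinset_eq_filter]
  have hsub : ({p : V × V | G.Adj p.1 p.2} : Finset (V × V)) ⊆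
      {p ∈ W ×ˢ W | G.Adj p.1 p.2} ∪ (Wᶜ ×ˢ univ ∪ univ ×ˢ Wᶜ) := by
    rintro ⟨u, v⟩ h
    simp only [mem_filter, mem_union, mem_product, mem_univ, mem_compl] at h ⊢
    tauto
  have h₁ := card_le_card hsub
  have h₂ := card_union_le {p ∈ W ×ˢ W | G.Adj p.1 p.2} (Wᶜ ×ˢ univ ∪ univ ×ˢ Wᶜ)
  have h₃ := card_union_le (Wᶜ ×ˢ (univ : Finset V)) (univ ×ˢ Wᶜ)
  simp only [card_product, card_univ] at h₃
  rw [mul_comm (Fintype.card V)] at h₃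
  omega

open Finset in
/-- If no path of length `2` inside `W` joins `A` to `B`, where `|A| = |B| = t`, then
the number of adjacent ordered pairs in `W` is bounded. -/
lemma card_adj_pairs_add_le_of_forall_eq {V : Type*} [DecidableEq V] (G : SimpleGraph V)
    [DecidableRel G.Adj] (W A B : Finset V) (t : ℕ) (hA : A ⊆ W) (hB : B ⊆ W)
    (hAt : #A = t) (hBt : #B = t)
    (h : ∀ b ∈ W, ∀ a ∈ A, ∀ c ∈ B, G.Adj b a → G.Adj b c → a = c) :
    #{p ∈ W ×ˢ W | G.Adj p.1 p.2} + 2 * t * #W ≤ #W ^ 2 + 2 * t ^ 2 + 2 * #W := by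
  classical
  let p : V → Prop := fun u => ∀ v ∈ B, ∀ w ∈ B, G.Adj u v → G.Adj u w → v = w
  have hW : W.filter p ∪ W.filter (fun u => ¬ p u) = W := filter_union_filter_not_eq p W
  have := card_adj_pairs_add_le G (W.filter p) (W.filter (fun u => ¬ p u)) A B t
    (disjoint_filter_filter_not _ _ _) (hW.symm ▸ hA) (hW.symm ▸ hB) hAt hBt
    (fun u hu => (mem_filter.mp hu).2) (by
      intro u hu v hv w hw huv huw
      rw [mem_filter] at hu
      obtain ⟨huW, hu⟩ := hu
      simp only [p] at hu
      push Not at hu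
      obtain ⟨c, hc, -, -, huc, -, -⟩ := hu
      rw [h u huW v hv c hc huv huc, h u huW w hw c hc huw huc])
  rwa [hW] at this

/-- Let `k ≥ 2` and let `G` be a simple graph with `n ≥ 2k` vertices and `e ≥ n²/4 + 2kn`
edges whose minimum degree `δ` satisfies `δ ≥ n/2 - √(e - 2kn - n²/4) + 2k`. Then for every
vertex set `T` with `|T| ≤ 2k - 4` and any two vertices `x, y ∉ T`, there is a path of length
exactly `4` from `x` to `y` in `G` avoiding all vertices of `T`. -/
theorem statement10 {V : Type} [Fintype V] (G : SimpleGraph V) [DecidableRel G.Adj]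
    (k n e : ℕ) (hk : 2 ≤ k) (hn : Fintype.card V = n) (he : G.edgeSet.ncard = e)
    (hn' : 2 * k ≤ n) (he' : (n : ℝ) ^ 2 / 4 + 2 * (k : ℝ) * (n : ℝ) ≤ (e : ℝ))
    (hδ : ∀ v : V, (n : ℝ) / 2 - Real.sqrt ((e : ℝ) - 2 * (k : ℝ) * (n : ℝ) - (n : ℝ) ^ 2 / 4)
      + 2 * (k : ℝ) ≤ (G.degree v : ℝ)) :
    ∀ T : Finset V, T.card ≤ 2 * k - 4 → ∀ x y : V, x ∉ T → y ∉ T → x ≠ y →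
      ∃ p : G.Walk x y, p.IsPath ∧ p.length = 4 ∧ ∀ z ∈ p.support, z ∉ T := by
  classical
  intro T hT x y hx hy hxy
  by_contra hno
  set s := Real.sqrt ((e : ℝ) - 2 * (k : ℝ) * (n : ℝ) - (n : ℝ) ^ 2 / 4)
  have hs0 : 0 ≤ s := Real.sqrt_nonneg _
  have hs2 : s ^ 2 = (e : ℝ) - 2 * (k : ℝ) * (n : ℝ) - (n : ℝ) ^ 2 / 4 :=
    Real.sq_sqrt (by linarith)
  set R : Finset V := insert x (insert y T) with hR
  have hRcard : R.card = T.card + 2 := by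
    rw [hR, Finset.card_insert_of_notMem (by simp [hxy, hx]), Finset.card_insert_of_notMem hy]
  have hTk : T.card + 4 ≤ 2 * k := by omega
  have hTk' : (T.card : ℝ) + 4 ≤ 2 * k := by exact_mod_cast hTk
  have hnbr : ∀ v ∈ R, (n : ℝ) / 2 - s + 3 ≤ ((G.neighborFinset v \ R).card : ℝ) := by
    intro v hv
    have h₁ : (G.neighborFinset v).card ≤ (G.neighborFinset v \ R).card + (R.erase v).card := by
      refine le_trans (Finset.card_le_card fun w hw => ?_) (Finset.card_union_le _ _)
      have : w ≠ v := by
        rintro rfl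
        simp at hw
      simp only [Finset.mem_union, Finset.mem_sdiff, Finset.mem_erase]
      tauto
    rw [Finset.card_erase_of_mem hv, G.card_neighborFinset_eq_degree] at h₁
    have h₂ : (G.degree v : ℝ) ≤ (G.neighborFinset v \ R).card + (T.card + 1) := by
      exact_mod_cast (by omega : G.degree v ≤ (G.neighborFinset v \ R).card + (T.card + 1))
    linarith [hδ v]
  set t := ⌈(n : ℝ) / 2 - s + 3⌉₊
  obtain ⟨A, hAsub, hAt⟩ := Finset.exists_subset_card_eq
    (Nat.ceil_le.mpr (hnbr x (by simp [hR])))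
  obtain ⟨B, hBsub, hBt⟩ := Finset.exists_subset_card_eq
    (Nat.ceil_le.mpr (hnbr y (by simp [hR])))
  have hA : ∀ a ∈ A, G.Adj x a ∧ a ∉ R := fun a ha => by simpa using hAsub ha
  have hB : ∀ b ∈ B, G.Adj y b ∧ b ∉ R := fun b hb => by simpa using hBsub hb
  have key := card_adj_pairs_add_le_of_forall_eq G Rᶜ A B t
    (fun a ha => Finset.mem_compl.mpr (hA a ha).2) (fun b hb => Finset.mem_compl.mpr (hB b hb).2)
    hAt hBt (by
      intro b hb a ha c hc hba hbc
      by_contra hac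
      apply hno
      obtain ⟨hxa, haR⟩ := hA a ha
      obtain ⟨hyc, hcR⟩ := hB c hc
      have hab := hba.ne
      have hbc' := hbc.ne
      simp only [hR, Finset.mem_compl, Finset.mem_insert, not_or] at hb haR hcR
      refine ⟨.cons hxa (.cons hba.symm (.cons hbc (.cons hyc.symm .nil))), ?_, rfl, ?_⟩
      · simp only [Walk.cons_isPath_iff, Walk.isPath_iff_nil, Walk.nil_nil, Walk.support_cons,
          Walk.support_nil, List.mem_cons, List.not_mem_nil, or_false, not_or]
        grind
      · simp only [Walk.support_cons, Walk.support_nil, List.mem_cons, List.not_mem_nil]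
        grind)
  have hedge := two_mul_ncard_edgeSet_le G Rᶜ
  have hmax := two_mul_ncard_edgeSet_le G (Finset.univ : Finset V)
  have hme : 2 * e ≤ n ^ 2 := by
    have h₁ := Finset.card_filter_le ((Finset.univ : Finset V) ×ˢ (Finset.univ : Finset V))
      (fun p => G.Adj p.1 p.2)
    rw [Finset.card_product, Finset.card_univ, hn] at h₁
    rw [Finset.compl_univ, Finset.card_empty, he] at hmax
    rw [pow_two]
    omega
  rw [compl_compl, he, hn] at hedge
  have hm : (Rᶜ.card : ℝ) = n - (T.card + 2) := by
    have : Rᶜ.card + R.card = n := by rw [Finset.card_compl_add_card, hn]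
    rw [← this, hRcard]
    push_cast
    ring
  have hcomb : 2 * e + 2 * t * Rᶜ.card ≤
      Rᶜ.card ^ 2 + 2 * t ^ 2 + 2 * Rᶜ.card + 2 * ((T.card + 2) * n) := by
    rw [← hRcard]
    omega
  have hcombR : 2 * (e : ℝ) + 2 * t * Rᶜ.card ≤
      (Rᶜ.card : ℝ) ^ 2 + 2 * t ^ 2 + 2 * Rᶜ.card + 2 * ((T.card + 2) * n) := by
    exact_mod_cast hcomb
  have hmeR : 2 * (e : ℝ) ≤ (n : ℝ) ^ 2 := by exact_mod_cast hme
  have hk' : (2 : ℝ) ≤ k := by exact_mod_cast hk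
  have hr : (2 : ℝ) ≤ T.card + 2 := by linarith [Nat.cast_nonneg (α := ℝ) T.card]
  have hn0 : (0 : ℝ) < n := by
    have : 0 < n := by omega
    exact_mod_cast this
  have hsn : s ≤ (n : ℝ) / 2 := by
    have : 0 ≤ (k : ℝ) * n := by positivity
    exact abs_le_of_sq_le_sq' (by nlinarith) (by positivity) |>.2
  have hkn : 8 * (k : ℝ) ≤ n := by
    by_contra! hlt
    nlinarith
  have ht₁ : (n : ℝ) / 2 - s + 3 ≤ t := Nat.le_ceil _
  have ht₂ : (t : ℝ) < (n : ℝ) / 2 - s + 3 + 1 := Nat.ceil_lt_add_one (by linarith)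
  rw [hm] at hcombR
  have hr' : (T.card : ℝ) + 2 ≤ 2 * k - 2 := by linarith
  generalize (T.card : ℝ) + 2 = r at *
  obtain ⟨c, hc⟩ : ∃ c : ℝ, (t : ℝ) = n / 2 - s + c := ⟨t - (n / 2 - s), by ring⟩
  rw [hc] at hcombR ht₁ ht₂
  have hc₁ : 3 ≤ c := by linarith
  have hc₂ : c ≤ 4 := by linarith
  have hmain : 4 * k * n - r * n - 2 * n + (4 * c + 2 * r) * s - r ^ 2 - 2 * c ^ 2 - 2 * r * c
      + 2 * r ≤ 0 := by
    linear_combination hcombR + 2 * hs2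
  have h₁ : 0 ≤ (4 * c + 2 * r) * s := by positivity
  have h₂ : r * n ≤ (2 * k - 2) * n := by gcongr
  have h₃ : (8 * k) * k ≤ n * (k : ℝ) := by gcongr
  have h₄ : r ^ 2 ≤ (2 * k - 2) ^ 2 := by gcongr
  have h₅ : c ^ 2 ≤ 4 ^ 2 := by gcongr
  have h₆ : r * c ≤ (2 * k - 2) * 4 := by
    gcongr
    linarith
  nlinarith
end
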